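/- For all natural numbers a, b, c, the following identity holds in the polynomial ring ℤ[q]: (∑_T q^{|T|}) · H(a+b)_q · H(a+c)_q · H(b+c)_q = H(a+b+c)_q · H(a)_q · H(b)_q · H(c)_q, where the sum is over all plane partitions T in the a×b×c box. -/

import Mathlib

/-- A plane partition in an `a × b × c` box: a lower set of `Fin a × Fin b × Fin c`
for the componentwise order. -/
def IsPP (a b c : ℕ) (T : Finset (Fin a × Fin b × Fin c)) : Prop :=
  ∀ p ∈ T, ∀ q : Fin a × Fin b × Fin c,
    q.1 ≤ p.1 → q.2.1 ≤ p.2.1 → q.2.2 ≤ p.2.2 → q ∈ T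

set_option synthInstance.maxSize 400 in
instance (a b c : ℕ) : DecidablePred (IsPP a b c) := fun _ => by
  unfold IsPP; infer_instance

open Polynomial

/-- The `q`-integer `(n)_q = 1 + q + ⋯ + q^(n-1)` in `ℤ[q]`. -/
noncomputable def qInt (n : ℕ) : Polynomial ℤ := ∑ k ∈ Finset.range n, X ^ k

/-- The `q`-factorial `(n)_q! = (1)_q (2)_q ⋯ (n)_q`. -/
noncomputable def qFactorial (n : ℕ) : Polynomial ℤ := ∏ k ∈ Finset.range n, qInt (k + 1)

/-- The `q`-hyperfactorial `H(n)_q = ∏_{k=0}^{n-1} (k)_q!`. -/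
noncomputable def qHyperfactorial (n : ℕ) : Polynomial ℤ := ∏ k ∈ Finset.range n, qFactorial k

/-- Subtracting consecutive rows of a Vandermonde matrix removes its first row and column. -/
lemma det_vandermonde_succ_eq_det_sub {R : Type*} [CommRing R] {n : ℕ} (v : Fin (n + 1) → R) :
    (Matrix.vandermonde v).det =
      (Matrix.of fun i j : Fin n =>
        v i.succ ^ ((j : ℕ) + 1) - v i.castSucc ^ ((j : ℕ) + 1)).det := by
  let B : Matrix (Fin (n + 1)) (Fin (n + 1)) R := Matrix.of fun i j =>
    Fin.cases (v 0 ^ (j : ℕ)) (fun i => v i.succ ^ (j : ℕ) - v i.castSucc ^ (j : ℕ)) i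
  have hB : (Matrix.vandermonde v).det = B.det := by
    refine Matrix.det_eq_of_forall_row_eq_smul_add_pred (fun _ => 1) ?_ ?_
    · intro j; simp [B, Matrix.vandermonde_apply]
    · intro i j; simp [B, Matrix.vandermonde_apply]
  rw [hB, Matrix.det_succ_column_zero, Fin.sum_univ_succ]
  simp only [Fin.val_zero, pow_zero, one_mul]
  rw [Finset.sum_eq_zero (s := Finset.univ)]
  · simp only [B, add_zero, Matrix.of_apply, Fin.cases_zero, Fin.val_zero, pow_zero, one_mul]
    congr 1
  · intro i _; simp [B]

lemma sub_one_mul_sum_Icc_pow {R : Type*} [CommRing R] (q : R) (i d s t : ℕ) (h : s ≤ t) :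
    (q ^ d - 1) * ∑ m ∈ Finset.Icc s t, (q ^ (m + i)) ^ d =
      (q ^ (t + (i + 1))) ^ d - (q ^ (s + i)) ^ d := by
  induction t, h using Nat.le_induction with
  | base => simp; ring
  | succ t h ih =>
    rw [← Finset.insert_Icc_right_eq_Icc_add_one (by omega), Finset.sum_insert (by simp), mul_add, ih]
    ring

/-- Summing an alternant over all rows interlacing a given row gives a larger alternant. -/
lemma det_vandermonde_eq_sum_interlacing {R : Type*} [CommRing R] (q : R) {n : ℕ}
    (l : Fin (n + 1) → ℕ) (hl : Monotone l) :
    (Matrix.vandermonde fun i => q ^ (l i + (i : ℕ))).det =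
      (∏ j ∈ Finset.range n, (q ^ (j + 1) - 1)) *
        ∑ m ∈ Fintype.piFinset fun i : Fin n => Finset.Icc (l i.castSucc) (l i.succ),
          q ^ (∑ i, (m i + (i : ℕ))) *
            (Matrix.vandermonde fun i => q ^ (m i + (i : ℕ))).det := by
  have h1 : ∀ m : Fin n → ℕ, q ^ (∑ i, (m i + (i : ℕ))) *
      (Matrix.vandermonde fun i => q ^ (m i + (i : ℕ))).det =
      (Matrix.detRowAlternating (R := R) (n := Fin n)).toMultilinearMap
        (fun i j => (q ^ (m i + (i : ℕ))) ^ ((j : ℕ) + 1)) := by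
    intro m
    rw [← Finset.prod_pow_eq_pow_sum, ← Matrix.det_mul_column]
    change _ = Matrix.det _
    congr 1
    ext i j
    simp [Matrix.vandermonde_apply, pow_succ']
  have h2 := MultilinearMap.map_sum_finset
    (Matrix.detRowAlternating (R := R) (n := Fin n)).toMultilinearMap
    (fun (i : Fin n) (t : ℕ) => fun j : Fin n => (q ^ (t + (i : ℕ))) ^ ((j : ℕ) + 1))
    (fun i : Fin n => Finset.Icc (l i.castSucc) (l i.succ))
  rw [det_vandermonde_succ_eq_det_sub, Finset.sum_congr rfl fun m _ => h1 m, ← h2,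
    ← Fin.prod_univ_eq_prod_range (fun j => q ^ (j + 1) - 1)]
  change _ = _ * Matrix.det (Matrix.of fun i : Fin n =>
    ∑ t ∈ Finset.Icc (l i.castSucc) (l i.succ), fun j : Fin n =>
      (q ^ (t + (i : ℕ))) ^ ((j : ℕ) + 1))
  rw [← Matrix.det_mul_row]
  congr 1
  ext i j
  simp only [Matrix.of_apply, Finset.sum_apply]
  rw [sub_one_mul_sum_Icc_pow _ _ _ _ _ (hl (Fin.castSucc_le_succ i))]
  simp

/-- Gelfand–Tsetlin patterns of size `n` with top row `l`, as arrays indexed by the triangle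
`i + j < n` and extended by zero; the top row is the antidiagonal `i + j + 1 = n`. -/
structure IsGTPattern (n : ℕ) (l : Fin n → ℕ) (f : ℕ → ℕ → ℕ) : Prop where
  zero : ∀ i j, n ≤ i + j → f i j = 0
  top : ∀ i : Fin n, f i (n - 1 - i) = l i
  anti : ∀ i j, i + j + 1 < n → f i (j + 1) ≤ f i j
  mono : ∀ i j, i + j + 1 < n → f i j ≤ f (i + 1) j

/-- The sum of the shifted entries of a Gelfand–Tsetlin pattern below its top row. -/
def gtWeight (n : ℕ) (f : ℕ → ℕ → ℕ) : ℕ :=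
  ∑ i ∈ Finset.range n, ∑ j ∈ Finset.range (n - 1 - i), (f i j + i)

/-- Place a new top row `l` above a triangular array of size `n`. -/
def gtExtend {n : ℕ} (l : Fin (n + 1) → ℕ) (f : ℕ → ℕ → ℕ) (i j : ℕ) : ℕ :=
  if h : i + j = n then l ⟨i, by omega⟩ else f i j

lemma gtWeight_succ_gtExtend {n : ℕ} {l : Fin (n + 1) → ℕ} {m : Fin n → ℕ} {f : ℕ → ℕ → ℕ}
    (hf : IsGTPattern n m f) :
    gtWeight (n + 1) (gtExtend l f) = ∑ i, (m i + (i : ℕ)) + gtWeight n f := by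
  have h : ∑ i, (m i + (i : ℕ)) = ∑ i ∈ Finset.range n, (f i (n - 1 - i) + i) := by
    rw [← Fin.sum_univ_eq_sum_range (fun i => f i (n - 1 - i) + i)]
    exact Finset.sum_congr rfl fun i _ => by rw [hf.top]
  rw [h, gtWeight, gtWeight, Finset.sum_range_succ, ← Finset.sum_add_distrib]
  simp only [add_tsub_cancel_right, tsub_self, Finset.range_zero, Finset.sum_empty, add_zero]
  refine Finset.sum_congr rfl fun i hi => ?_
  rw [Finset.mem_range] at hi
  rw [show n - i = (n - 1 - i) + 1 by omega, Finset.sum_range_succ, add_comm]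
  congr 1
  · rw [gtExtend, dif_neg (by omega)]
  · refine Finset.sum_congr rfl fun j hj => ?_
    rw [Finset.mem_range] at hj
    rw [gtExtend, dif_neg (by omega)]

lemma IsGTPattern.extend {n : ℕ} {l : Fin (n + 1) → ℕ} {m : Fin n → ℕ} {f : ℕ → ℕ → ℕ}
    (hf : IsGTPattern n m f) (hm : ∀ i, l i.castSucc ≤ m i ∧ m i ≤ l i.succ) :
    IsGTPattern (n + 1) l (gtExtend l f) where
  zero i j h := by
    rw [gtExtend, dif_neg (by omega)]
    exact hf.zero _ _ (by omega)
  top i := by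
    rw [gtExtend, dif_pos (by omega)]
  anti i j h := by
    by_cases h' : i + j + 1 = n
    · have ht := hf.top ⟨i, by omega⟩
      simp only [show n - 1 - i = j by omega] at ht
      rw [gtExtend, gtExtend, dif_pos (by omega), dif_neg (by omega), ht]
      exact (hm ⟨i, by omega⟩).1
    · rw [gtExtend, gtExtend, dif_neg (by omega), dif_neg (by omega)]
      exact hf.anti _ _ (by omega)
  mono i j h := by
    by_cases h' : i + j + 1 = n
    · have ht := hf.top ⟨i, by omega⟩
      simp only [show n - 1 - i = j by omega] at ht
      rw [gtExtend, gtExtend, dif_neg (by omega), dif_pos (by omega), ht]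
      exact (hm ⟨i, by omega⟩).2
    · rw [gtExtend, gtExtend, dif_neg (by omega), dif_neg (by omega)]
      exact hf.mono _ _ (by omega)

lemma IsGTPattern.exists_eq_gtExtend {n : ℕ} {l : Fin (n + 1) → ℕ} {f : ℕ → ℕ → ℕ}
    (hf : IsGTPattern (n + 1) l f) :
    ∃ (m : Fin n → ℕ) (g : ℕ → ℕ → ℕ), (∀ i, l i.castSucc ≤ m i ∧ m i ≤ l i.succ) ∧
      IsGTPattern n m g ∧ gtExtend l g = f := by
  refine ⟨fun i => f i (n - 1 - i), fun i j => if i + j < n then f i j else 0, fun i => ⟨?_, ?_⟩,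
    ⟨?_, ?_, ?_, ?_⟩, ?_⟩
  · have h := hf.anti i (n - 1 - i) (by omega)
    rw [show n - 1 - (i : ℕ) + 1 = n + 1 - 1 - (i : ℕ) by omega] at h
    simpa using (hf.top i.castSucc).symm.trans_le h
  · have h := hf.mono i (n - 1 - i) (by omega)
    have ht := hf.top i.succ
    simp only [Fin.val_succ] at ht
    rw [show n + 1 - 1 - ((i : ℕ) + 1) = n - 1 - i by omega] at ht
    exact h.trans_eq ht
  · intro i j h
    rw [if_neg (by omega)]
  · intro i
    rw [if_pos (by omega)]
  · intro i j h
    rw [if_pos (by omega), if_pos (by omega)]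
    exact hf.anti _ _ (by omega)
  · intro i j h
    rw [if_pos (by omega), if_pos (by omega)]
    exact hf.mono _ _ (by omega)
  · ext i j
    rw [gtExtend]
    split_ifs with h1 h2
    · have ht := hf.top ⟨i, by omega⟩
      simp only [show n + 1 - 1 - i = j by omega] at ht
      exact ht.symm
    · rfl
    · exact (hf.zero _ _ (by omega)).symm

lemma gtExtend_inj {n : ℕ} {l : Fin (n + 1) → ℕ} {m m' : Fin n → ℕ} {f f' : ℕ → ℕ → ℕ}
    (hf : IsGTPattern n m f) (hf' : IsGTPattern n m' f') (h : gtExtend l f = gtExtend l f') :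
    m = m' ∧ f = f' := by
  have hff : f = f' := by
    ext i j
    by_cases hij : i + j = n
    · rw [hf.zero _ _ hij.ge, hf'.zero _ _ hij.ge]
    · have := congrFun (congrFun h i) j
      rwa [gtExtend, gtExtend, dif_neg hij, dif_neg hij] at this
  refine ⟨?_, hff⟩
  ext i
  rw [← hf.top, ← hf'.top, hff]

/-- The principally specialized alternant with exponents `l i + i` is the Vandermonde-type
constant times the generating function of Gelfand–Tsetlin patterns with top row `l`. -/
lemma exists_finset_isGTPattern {R : Type*} [CommRing R] (q : R) (n : ℕ) (l : Fin n → ℕ)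
    (hl : Monotone l) :
    ∃ S : Finset (ℕ → ℕ → ℕ), (∀ f, f ∈ S ↔ IsGTPattern n l f) ∧
      (Matrix.vandermonde fun i => q ^ (l i + (i : ℕ))).det =
        (∏ k ∈ Finset.range n, ∏ j ∈ Finset.range k, (q ^ (j + 1) - 1)) *
          ∑ f ∈ S, q ^ gtWeight n f := by
  classical
  induction n with
  | zero =>
    refine ⟨{0}, fun f => ?_, by simp [gtWeight]⟩
    rw [Finset.mem_singleton]
    constructor
    · rintro rfl
      exact ⟨fun _ _ _ => rfl, fun i => i.elim0, fun _ _ h => by omega, fun _ _ h => by omega⟩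
    · intro h
      ext i j
      exact h.zero _ _ (Nat.zero_le _)
  | succ n ih =>
    let P : Finset (Fin n → ℕ) :=
      Fintype.piFinset fun i : Fin n => Finset.Icc (l i.castSucc) (l i.succ)
    have hP : ∀ m, m ∈ P ↔ ∀ i, l i.castSucc ≤ m i ∧ m i ≤ l i.succ := by
      simp [P, Fintype.mem_piFinset]
    have hmono : ∀ m ∈ P, Monotone m := by
      intro m hm i j hij
      rw [hP] at hm
      rcases hij.eq_or_lt with rfl | hlt
      · rfl
      · exact (hm i).2.trans ((hl (Fin.succ_le_castSucc_iff.2 hlt)).trans (hm j).1)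
    have ih' : ∀ m : Fin n → ℕ, ∃ S : Finset (ℕ → ℕ → ℕ), m ∈ P →
        (∀ f, f ∈ S ↔ IsGTPattern n m f) ∧
        (Matrix.vandermonde fun i => q ^ (m i + (i : ℕ))).det =
        (∏ k ∈ Finset.range n, ∏ j ∈ Finset.range k, (q ^ (j + 1) - 1)) *
          ∑ f ∈ S, q ^ gtWeight n f := by
      intro m
      by_cases hm : m ∈ P
      · obtain ⟨S, hS⟩ := ih m (hmono m hm)
        exact ⟨S, fun _ => hS⟩
      · exact ⟨∅, fun h => absurd h hm⟩
    choose S hS using ih'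
    refine ⟨(P.sigma S).image fun x => gtExtend l x.2, fun f => ?_, ?_⟩
    · simp only [Finset.mem_image, Finset.mem_sigma, Sigma.exists]
      constructor
      · rintro ⟨m, g, ⟨hm, hg⟩, rfl⟩
        exact (((hS m hm).1 g).1 hg).extend ((hP m).1 hm)
      · intro hf
        obtain ⟨m, g, hm, hg, rfl⟩ := hf.exists_eq_gtExtend
        have hm' := (hP m).2 hm
        exact ⟨m, g, ⟨hm', ((hS m hm').1 g).2 hg⟩, rfl⟩
    · rw [Finset.sum_image, Finset.sum_sigma, det_vandermonde_eq_sum_interlacing q l hl,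
        Finset.prod_range_succ, mul_assoc, mul_left_comm]
      · congr 1
        rw [Finset.mul_sum]
        refine Finset.sum_congr rfl fun m hm => ?_
        rw [(hS m hm).2, mul_left_comm, Finset.mul_sum]
        congr 1
        refine Finset.sum_congr rfl fun f hf => ?_
        rw [gtWeight_succ_gtExtend (((hS m hm).1 f).1 hf), pow_add]
      · rintro ⟨m, f⟩ hx ⟨m', f'⟩ hx' h
        simp only [Finset.coe_sigma, Set.mem_sigma_iff, Finset.mem_coe] at hx hx'
        obtain ⟨rfl, rfl⟩ := gtExtend_inj (((hS m hx.1).1 f).1 hx.2)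
          (((hS m' hx'.1).1 f').1 hx'.2) h
        rfl

lemma det_vandermonde_eq_prod_range {R : Type*} [CommRing R] (n : ℕ) (v : ℕ → R) :
    (Matrix.vandermonde fun i : Fin n => v i).det =
      ∏ j ∈ Finset.range n, ∏ i ∈ Finset.range j, (v j - v i) := by
  rw [Matrix.det_vandermonde, Finset.prod_comm' (t' := Finset.univ) (s' := fun j => Finset.Iio j)
    (by simp), ← Fin.prod_univ_eq_prod_range (fun j => ∏ i ∈ Finset.range j, (v j - v i))]
  refine Finset.prod_congr rfl fun j _ => ?_
  refine Finset.prod_bij (fun i _ => (i : ℕ)) ?_ ?_ ?_ ?_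
  · intro i hi; simpa using hi
  · intro i _ i' _ h; exact Fin.ext h
  · intro k hk
    rw [Finset.mem_range] at hk
    exact ⟨⟨k, hk.trans j.2⟩, by simpa [Fin.lt_def] using hk, rfl⟩
  · intro i _; rfl

lemma prod_range_pow_sub_pow {R : Type*} [CommRing R] (q : R) (k m : ℕ) :
    ∏ i ∈ Finset.range k, (q ^ (m + k) - q ^ i) =
      q ^ (∑ i ∈ Finset.range k, i) * ∏ i ∈ Finset.range k, (q ^ (m + i + 1) - 1) := by
  rw [← Finset.prod_range_reflect (fun i => q ^ (m + i + 1) - 1), ← Finset.prod_pow_eq_pow_sum,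
    ← Finset.prod_mul_distrib]
  refine Finset.prod_congr rfl fun i hi => ?_
  rw [Finset.mem_range] at hi
  rw [mul_sub, ← pow_add, show i + (m + (k - 1 - i) + 1) = m + k by omega, mul_one]

/-- The Vandermonde product at the exponents of a rectangular partition, up to a power of `q`. -/
lemma exists_prod_rectangle {R : Type*} [CommRing R] (q : R) (a b c : ℕ) :
    ∃ e : ℕ, (Matrix.vandermonde fun i : Fin (a + c) =>
        q ^ ((if (i : ℕ) < a then 0 else b) + (i : ℕ))).det *
        (∏ k ∈ Finset.range (a + b), ∏ j ∈ Finset.range k, (q ^ (j + 1) - 1)) *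
        (∏ k ∈ Finset.range (b + c), ∏ j ∈ Finset.range k, (q ^ (j + 1) - 1)) =
      q ^ e * ((∏ k ∈ Finset.range (a + b + c), ∏ j ∈ Finset.range k, (q ^ (j + 1) - 1)) *
        (∏ k ∈ Finset.range a, ∏ j ∈ Finset.range k, (q ^ (j + 1) - 1)) *
        (∏ k ∈ Finset.range b, ∏ j ∈ Finset.range k, (q ^ (j + 1) - 1)) *
        (∏ k ∈ Finset.range c, ∏ j ∈ Finset.range k, (q ^ (j + 1) - 1))) := by
  have h1 : ∏ k ∈ Finset.range a, ∏ i ∈ Finset.range k,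
      (q ^ ((if k < a then 0 else b) + k) - q ^ ((if i < a then 0 else b) + i)) =
      q ^ (∑ k ∈ Finset.range a, ∑ i ∈ Finset.range k, i) *
        ∏ k ∈ Finset.range a, ∏ j ∈ Finset.range k, (q ^ (j + 1) - 1) := by
    rw [← Finset.prod_pow_eq_pow_sum, ← Finset.prod_mul_distrib]
    refine Finset.prod_congr rfl fun k hk => ?_
    rw [Finset.mem_range] at hk
    have := prod_range_pow_sub_pow q k 0
    simp only [zero_add] at this
    rw [← this]
    refine Finset.prod_congr rfl fun i hi => ?_
    rw [Finset.mem_range] at hi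
    rw [if_pos hk, if_pos (hi.trans hk), zero_add, zero_add]
  have h2 : (∏ k ∈ Finset.range c, ∏ i ∈ Finset.range (a + k),
      (q ^ ((if a + k < a then 0 else b) + (a + k)) - q ^ ((if i < a then 0 else b) + i))) *
        ∏ k ∈ Finset.range c, ∏ j ∈ Finset.range (b + k), (q ^ (j + 1) - 1) =
      q ^ (∑ k ∈ Finset.range c, (∑ i ∈ Finset.range a, i +
          ∑ i ∈ Finset.range k, (a + b + i))) *
        ((∏ k ∈ Finset.range c, ∏ j ∈ Finset.range k, (q ^ (j + 1) - 1)) *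
          ∏ k ∈ Finset.range c, ∏ j ∈ Finset.range (a + b + k), (q ^ (j + 1) - 1)) := by
    simp only [← Finset.prod_pow_eq_pow_sum, ← Finset.prod_mul_distrib]
    refine Finset.prod_congr rfl fun k hk => ?_
    have h3 := prod_range_pow_sub_pow q a (b + k)
    have h4 := prod_range_pow_sub_pow q k 0
    simp only [zero_add] at h4
    have h5 : ∏ i ∈ Finset.range k, (q ^ (b + (a + k)) - q ^ (b + (a + i))) =
        q ^ (∑ i ∈ Finset.range k, (a + b + i)) * ∏ j ∈ Finset.range k, (q ^ (j + 1) - 1) := by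
      have : ∀ i ∈ Finset.range k, q ^ (b + (a + k)) - q ^ (b + (a + i)) =
          q ^ (a + b) * (q ^ k - q ^ i) := fun i _ => by ring
      rw [Finset.prod_congr rfl this, Finset.prod_mul_distrib, h4, Finset.prod_pow_eq_pow_sum,
        ← mul_assoc, ← pow_add, ← Finset.sum_add_distrib]
    have h6 : ∏ i ∈ Finset.range a, (q ^ (b + (a + k)) - q ^ i) =
        q ^ (∑ i ∈ Finset.range a, i) * ∏ i ∈ Finset.range a, (q ^ (b + k + i + 1) - 1) := by
      rw [← h3, show b + (a + k) = b + k + a by omega]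
    rw [Finset.prod_range_add, show a + b + k = b + k + a by omega,
      Finset.prod_range_add _ (b + k) a]
    have h7 : ∏ x ∈ Finset.range a,
        (q ^ ((if a + k < a then 0 else b) + (a + k)) - q ^ ((if x < a then 0 else b) + x)) =
        ∏ i ∈ Finset.range a, (q ^ (b + (a + k)) - q ^ i) :=
      Finset.prod_congr rfl fun i hi => by
        rw [Finset.mem_range] at hi
        rw [if_neg (by omega), if_pos hi, zero_add]
    have h8 : ∏ x ∈ Finset.range k, (q ^ ((if a + k < a then 0 else b) + (a + k)) -
          q ^ ((if a + x < a then 0 else b) + (a + x))) =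
        ∏ i ∈ Finset.range k, (q ^ (b + (a + k)) - q ^ (b + (a + i))) :=
      Finset.prod_congr rfl fun i hi => by
        rw [if_neg (by omega), if_neg (by omega)]
    rw [h7, h8, h5, h6, pow_add]
    ring
  refine ⟨∑ k ∈ Finset.range a, ∑ i ∈ Finset.range k, i +
    ∑ k ∈ Finset.range c, (∑ i ∈ Finset.range a, i + ∑ i ∈ Finset.range k, (a + b + i)), ?_⟩
  rw [det_vandermonde_eq_prod_range (a + c) (fun i => q ^ ((if i < a then 0 else b) + i)),
    Finset.prod_range_add _ a c, h1, Finset.prod_range_add _ b c, Finset.prod_range_add _ (a + b) c,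
    pow_add]
  linear_combination (q ^ (∑ k ∈ Finset.range a, ∑ i ∈ Finset.range k, i) *
    (∏ k ∈ Finset.range a, ∏ j ∈ Finset.range k, (q ^ (j + 1) - 1)) *
    (∏ k ∈ Finset.range (a + b), ∏ j ∈ Finset.range k, (q ^ (j + 1) - 1)) *
    ∏ k ∈ Finset.range b, ∏ j ∈ Finset.range k, (q ^ (j + 1) - 1)) * h2

/-- The height of `T` over the position `(x, z)`. -/
def ppHeight {a b c : ℕ} (T : Finset (Fin a × Fin b × Fin c)) (x : Fin a) (z : Fin c) : ℕ :=
  (Finset.univ.filter fun k : Fin b => (x, k, z) ∈ T).card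

lemma ppHeight_le {a b c : ℕ} (T : Finset (Fin a × Fin b × Fin c)) (x : Fin a) (z : Fin c) :
    ppHeight T x z ≤ b :=
  (Finset.card_le_univ _).trans_eq (Fintype.card_fin b)

lemma card_eq_sum_ppHeight {a b c : ℕ} (T : Finset (Fin a × Fin b × Fin c)) :
    T.card = ∑ x, ∑ z, ppHeight T x z := by
  have h : T.card = ∑ p : Fin a × Fin b × Fin c, if p ∈ T then 1 else 0 := by simp
  rw [h, Fintype.sum_prod_type]
  refine Finset.sum_congr rfl fun x _ => ?_
  rw [Fintype.sum_prod_type_right]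
  refine Finset.sum_congr rfl fun z _ => ?_
  rw [ppHeight, Finset.card_filter]

lemma IsPP.mem_iff_lt_ppHeight {a b c : ℕ} {T : Finset (Fin a × Fin b × Fin c)} (hT : IsPP a b c T)
    (x : Fin a) (k : Fin b) (z : Fin c) : (x, k, z) ∈ T ↔ (k : ℕ) < ppHeight T x z := by
  constructor
  · intro h
    have : Finset.Iic k ⊆ Finset.univ.filter fun k : Fin b => (x, k, z) ∈ T := by
      intro k' hk'
      rw [Finset.mem_Iic] at hk'
      simpa using hT _ h (x, k', z) le_rfl hk' le_rfl
    have := Finset.card_le_card this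
    rw [Fin.card_Iic] at this
    exact this
  · intro h
    by_contra hk
    have : (Finset.univ.filter fun k : Fin b => (x, k, z) ∈ T) ⊆ Finset.Iio k := by
      intro k' hk'
      rw [Finset.mem_filter] at hk'
      rw [Finset.mem_Iio]
      by_contra hlt
      exact hk (hT _ hk'.2 (x, k, z) le_rfl (not_lt.1 hlt) le_rfl)
    have := Finset.card_le_card this
    rw [Fin.card_Iio] at this
    exact absurd h this.not_gt

lemma IsPP.ppHeight_anti {a b c : ℕ} {T : Finset (Fin a × Fin b × Fin c)} (hT : IsPP a b c T)
    {x x' : Fin a} {z z' : Fin c} (hx : x ≤ x') (hz : z ≤ z') : ppHeight T x' z' ≤ ppHeight T x z := by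
  refine Finset.card_le_card fun k hk => ?_
  rw [Finset.mem_filter] at hk ⊢
  exact ⟨hk.1, hT _ hk.2 (x, k, z) hx le_rfl hz⟩

/-- The Gelfand–Tsetlin pattern with rectangular top row encoding a plane partition. -/
def ppPattern {a b c : ℕ} (T : Finset (Fin a × Fin b × Fin c)) (i j : ℕ) : ℕ :=
  if h : i < a ∧ j < c then ppHeight T (Fin.rev ⟨i, h.1⟩) ⟨j, h.2⟩
  else if a ≤ i ∧ i + j < a + c then b else 0

/-- The plane partition encoded by a Gelfand–Tsetlin pattern with rectangular top row. -/
def patternPP (a b c : ℕ) (f : ℕ → ℕ → ℕ) : Finset (Fin a × Fin b × Fin c) :=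
  Finset.univ.filter fun p => (p.2.1 : ℕ) < f (Fin.rev p.1) p.2.2

lemma gtWeight_ppPattern {a b c : ℕ} (T : Finset (Fin a × Fin b × Fin c)) :
    gtWeight (a + c) (ppPattern T) =
      gtWeight (a + c) (ppPattern (∅ : Finset (Fin a × Fin b × Fin c))) + T.card := by
  let g : ℕ → ℕ → ℕ := fun i j =>
    if h : i < a ∧ j < c then ppHeight T (Fin.rev ⟨i, h.1⟩) ⟨j, h.2⟩ else 0
  have h1 : ∀ i j, ppPattern T i j =
      ppPattern (∅ : Finset (Fin a × Fin b × Fin c)) i j + g i j := by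
    intro i j
    by_cases h : i < a ∧ j < c
    · simp [ppPattern, g, h, ppHeight]
    · simp [ppPattern, g, h]
  have h2 : ∑ i ∈ Finset.range (a + c), ∑ j ∈ Finset.range (a + c - 1 - i), g i j = T.card := by
    rw [Finset.sum_range_add, card_eq_sum_ppHeight, ← Equiv.sum_comp Fin.revPerm,
      Finset.sum_eq_zero (s := Finset.range c), add_zero, ← Fin.sum_univ_eq_sum_range
        (fun i => ∑ j ∈ Finset.range (a + c - 1 - i), g i j)]
    · refine Finset.sum_congr rfl fun i _ => ?_
      rw [show a + c - 1 - (i : ℕ) = c + (a - 1 - i) by omega, Finset.sum_range_add,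
        Finset.sum_eq_zero (s := Finset.range (a - 1 - i)), add_zero,
        ← Fin.sum_univ_eq_sum_range (fun j => g i j)]
      · refine Finset.sum_congr rfl fun j _ => ?_
        simp [g]
      · intro j _
        simp [g]
    · intro i _
      exact Finset.sum_eq_zero fun j _ => by simp [g]
  rw [gtWeight, gtWeight, ← h2, ← Finset.sum_add_distrib]
  refine Finset.sum_congr rfl fun i _ => ?_
  rw [← Finset.sum_add_distrib]
  refine Finset.sum_congr rfl fun j _ => ?_
  rw [h1]
  ring

lemma IsPP.isGTPattern {a b c : ℕ} {T : Finset (Fin a × Fin b × Fin c)} (hT : IsPP a b c T) :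
    IsGTPattern (a + c) (fun i => if (i : ℕ) < a then 0 else b) (ppPattern T) where
  zero i j h := by
    rw [ppPattern, dif_neg (by omega), if_neg (by omega)]
  top i := by
    rw [ppPattern, dif_neg (by omega)]
    split_ifs <;> omega
  anti i j h := by
    rw [ppPattern, ppPattern]
    split_ifs <;> first
      | omega
      | exact hT.ppHeight_anti le_rfl (Fin.mk_le_mk.2 (Nat.le_succ j))
  mono i j h := by
    rw [ppPattern, ppPattern]
    split_ifs <;> first
      | omega
      | exact ppHeight_le _ _ _
      | exact hT.ppHeight_anti (Fin.rev_le_rev.2 (Fin.mk_le_mk.2 (Nat.le_succ i))) le_rfl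

lemma IsGTPattern.anti_add {n : ℕ} {l : Fin n → ℕ} {f : ℕ → ℕ → ℕ} (hf : IsGTPattern n l f)
    (i j t : ℕ) (h : i + j + t < n) : f i (j + t) ≤ f i j := by
  induction t with
  | zero => rfl
  | succ t ih => exact (hf.anti i (j + t) (by omega)).trans (ih (by omega))

lemma IsGTPattern.mono_add {n : ℕ} {l : Fin n → ℕ} {f : ℕ → ℕ → ℕ} (hf : IsGTPattern n l f)
    (i j t : ℕ) (h : i + j + t < n) : f i j ≤ f (i + t) j := by
  induction t with
  | zero => rfl
  | succ t ih => exact (ih (by omega)).trans (hf.mono (i + t) j (by omega))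

lemma IsGTPattern.le_top {n : ℕ} {l : Fin n → ℕ} {f : ℕ → ℕ → ℕ} (hf : IsGTPattern n l f)
    (i j : ℕ) (h : i + j < n) : f i j ≤ l ⟨n - 1 - j, by omega⟩ := by
  rw [← hf.top]
  have := hf.mono_add i j (n - 1 - j - i) (by omega)
  rw [show i + (n - 1 - j - i) = n - 1 - j by omega] at this
  simpa only [show n - 1 - (n - 1 - j) = j by omega] using this

lemma IsGTPattern.top_le {n : ℕ} {l : Fin n → ℕ} {f : ℕ → ℕ → ℕ} (hf : IsGTPattern n l f)
    (i j : ℕ) (h : i + j < n) : l ⟨i, by omega⟩ ≤ f i j := by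
  rw [← hf.top]
  have := hf.anti_add i j (n - 1 - i - j) (by omega)
  rwa [show j + (n - 1 - i - j) = n - 1 - i by omega] at this

lemma IsGTPattern.isPP {a b c : ℕ} {l : Fin (a + c) → ℕ} {f : ℕ → ℕ → ℕ}
    (hf : IsGTPattern (a + c) l f) : IsPP a b c (patternPP a b c f) := by
  rintro ⟨x, k, z⟩ hp ⟨x', k', z'⟩ hx hk hz
  simp only [patternPP, Finset.mem_filter, Finset.mem_univ, true_and] at hp hx hk hz ⊢
  rw [Fin.le_def] at hx hk hz
  have h1 := hf.mono_add (Fin.rev x) z (x - x') (by rw [Fin.val_rev]; omega)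
  have h2 := hf.anti_add (Fin.rev x') z' (z - z') (by rw [Fin.val_rev]; omega)
  rw [show (Fin.rev x : ℕ) + (x - x') = Fin.rev x' by rw [Fin.val_rev, Fin.val_rev]; omega] at h1
  rw [show (z' : ℕ) + (z - z') = z by omega] at h2
  omega

lemma IsGTPattern.ppPattern_patternPP {a b c : ℕ} {f : ℕ → ℕ → ℕ}
    (hf : IsGTPattern (a + c) (fun i => if (i : ℕ) < a then 0 else b) f) :
    ppPattern (patternPP a b c f) = f := by
  ext i j
  rw [ppPattern]
  by_cases hij : i + j < a + c
  · have h1 := hf.le_top i j hij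
    have h2 := hf.top_le i j hij
    simp only at h1 h2
    split_ifs with h h'
    · have hb : f i j ≤ b := h1.trans (by split_ifs <;> omega)
      simp only [ppHeight, patternPP, Finset.mem_filter, Finset.mem_univ, true_and, Fin.rev_rev]
      rw [Fin.card_filter_val_lt, min_eq_right hb]
    · rw [if_neg (by omega)] at h2
      split_ifs at h1 <;> omega
    · rw [if_pos (by omega)] at h1
      omega
  · rw [dif_neg (by omega), if_neg (by omega), hf.zero _ _ (by omega)]

lemma IsPP.patternPP_ppPattern {a b c : ℕ} {T : Finset (Fin a × Fin b × Fin c)}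
    (hT : IsPP a b c T) : patternPP a b c (ppPattern T) = T := by
  ext ⟨x, k, z⟩
  rw [hT.mem_iff_lt_ppHeight]
  simp only [patternPP, Finset.mem_filter, Finset.mem_univ, true_and]
  rw [ppPattern, dif_pos ⟨(Fin.rev x).2, z.2⟩]
  simp only [Fin.eta, Fin.rev_rev]

lemma sum_isGTPattern_eq_sum_isPP {R : Type*} [CommRing R] (q : R) (a b c : ℕ)
    (S : Finset (ℕ → ℕ → ℕ))
    (hS : ∀ f, f ∈ S ↔ IsGTPattern (a + c) (fun i => if (i : ℕ) < a then 0 else b) f) :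
    ∑ f ∈ S, q ^ gtWeight (a + c) f =
      q ^ gtWeight (a + c) (ppPattern (∅ : Finset (Fin a × Fin b × Fin c))) *
        ∑ T ∈ Finset.univ.filter (IsPP a b c), q ^ T.card := by
  rw [Finset.mul_sum]
  refine Finset.sum_bij' (fun f _ => patternPP a b c f) (fun T _ => ppPattern T) ?_ ?_ ?_ ?_ ?_
  · intro f hf
    simpa using ((hS f).1 hf).isPP
  · intro T hT
    exact (hS _).2 (Finset.mem_filter.1 hT).2.isGTPattern
  · intro f hf
    exact ((hS f).1 hf).ppPattern_patternPP
  · intro T hT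
    exact (Finset.mem_filter.1 hT).2.patternPP_ppPattern
  · intro f hf
    rw [← pow_add, ← gtWeight_ppPattern, ((hS f).1 hf).ppPattern_patternPP]

lemma qInt_mul_X_sub_one (n : ℕ) : qInt n * (X - 1) = X ^ n - 1 :=
  geom_sum_mul X n

lemma coeff_zero_qInt_succ (n : ℕ) : (qInt (n + 1)).coeff 0 = 1 := by
  simp [qInt, coeff_X_pow]

lemma coeff_zero_qHyperfactorial (n : ℕ) : (qHyperfactorial n).coeff 0 = 1 := by
  simp only [qHyperfactorial, qFactorial, coeff_zero_prod, coeff_zero_qInt_succ,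
    Finset.prod_const_one]

lemma prod_X_pow_sub_one_eq (n : ℕ) :
    ∏ k ∈ Finset.range n, ∏ j ∈ Finset.range k, ((X : ℤ[X]) ^ (j + 1) - 1) =
      (X - 1) ^ n.choose 2 * qHyperfactorial n := by
  simp only [← qInt_mul_X_sub_one, Finset.prod_mul_distrib, Finset.prod_const, Finset.card_range,
    qHyperfactorial, qFactorial]
  rw [Finset.prod_pow_eq_pow_sum, Finset.sum_range_id, Nat.choose_two_right, mul_comm]

lemma eq_of_X_pow_mul_eq {P Q : ℤ[X]} {m n : ℕ} (hP : P.coeff 0 = 1) (hQ : Q.coeff 0 = 1)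
    (h : X ^ m * P = X ^ n * Q) : P = Q := by
  wlog hmn : m ≤ n generalizing P Q m n
  · exact (this hQ hP h.symm (le_of_not_ge hmn)).symm
  obtain ⟨d, rfl⟩ := Nat.exists_eq_add_of_le hmn
  rw [pow_add, mul_assoc] at h
  have h' := mul_left_cancel₀ (pow_ne_zero m X_ne_zero) h
  rcases d with _ | d
  · simpa using h'
  · rw [h'] at hP
    simp [mul_coeff_zero] at hP

lemma coeff_zero_sum_isPP (a b c : ℕ) :
    (∑ T ∈ Finset.univ.filter (IsPP a b c), (X : ℤ[X]) ^ T.card).coeff 0 = 1 := by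
  rw [finsetSum_coeff, Finset.sum_eq_single ∅]
  · simp
  · intro T _ hT
    rw [coeff_X_pow, if_neg]
    exact (Finset.card_pos.2 (Finset.nonempty_iff_ne_empty.2 hT)).ne
  · intro h
    exact absurd (Finset.mem_filter.2 ⟨Finset.mem_univ _, fun p hp => by simp at hp⟩) h

/-- MacMahon's `q`-box formula: the generating function of plane partitions in an
`a × b × c` box by number of cubes satisfies
`(∑_T q^|T|) · H(a+b)_q H(a+c)_q H(b+c)_q = H(a+b+c)_q H(a)_q H(b)_q H(c)_q` in `ℤ[q]`. -/
theorem planePartition_qcount (a b c : ℕ) :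
    (∑ T ∈ Finset.univ.filter (IsPP a b c), (X : Polynomial ℤ) ^ T.card) *
        qHyperfactorial (a + b) * qHyperfactorial (a + c) * qHyperfactorial (b + c) =
      qHyperfactorial (a + b + c) * qHyperfactorial a * qHyperfactorial b * qHyperfactorial c := by
  have hmono : Monotone fun i : Fin (a + c) => if (i : ℕ) < a then 0 else b := by
    intro i j hij
    rw [Fin.le_def] at hij
    dsimp only
    split_ifs <;> omega
  obtain ⟨S, hS, hdet⟩ := exists_finset_isGTPattern (X : ℤ[X]) (a + c) _ hmono
  obtain ⟨e, he⟩ := exists_prod_rectangle (X : ℤ[X]) a b c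
  rw [hdet, sum_isGTPattern_eq_sum_isPP _ _ _ _ _ hS] at he
  simp only [prod_X_pow_sub_one_eq] at he
  have hexp : (a + b).choose 2 + (a + c).choose 2 + (b + c).choose 2 =
      (a + b + c).choose 2 + a.choose 2 + b.choose 2 + c.choose 2 := by
    have hsucc (m n : ℕ) : (m + n).choose 2 = m.choose 2 + n.choose 2 + m * n := by
      induction n with
      | zero => simp
      | succ n ih =>
        rw [← add_assoc, Nat.choose_succ_succ' (m + n) 1, Nat.choose_succ_succ' n 1, ih]
        simp only [Nat.choose_one_right]
        ring
    simp only [hsucc]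
    ring
  refine eq_of_X_pow_mul_eq ?_ ?_ (mul_left_cancel₀ (pow_ne_zero
    ((a + b).choose 2 + (a + c).choose 2 + (b + c).choose 2) (X_sub_C_ne_zero (1 : ℤ)))
    (?_ : _ * (X ^ gtWeight (a + c) (ppPattern (∅ : Finset (Fin a × Fin b × Fin c))) * _) =
      _ * (X ^ e * _)))
  · simp only [mul_coeff_zero, coeff_zero_sum_isPP, coeff_zero_qHyperfactorial, mul_one]
  · simp only [mul_coeff_zero, coeff_zero_qHyperfactorial, mul_one]
  · rw [C_1]
    calc _ = _ := by simp only [pow_add]; ring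
      _ = _ := he
      _ = _ := by rw [hexp]; simp only [pow_add]; ring
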